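/- Let n ≥ 1, let α be a nonzero complex number and r₁, …, rₙ complex numbers, and define P(x) = α·∏_{i=1}^{n}(rᵢ - x). Assume that Re(P(x)) > 0 for every real x ∈ [-1, 1]. Then exp( (1/(2π)) ∫_{-π}^{π} Log(P(cos θ)) dθ ) = (α / 2ⁿ) · ∏_{i=1}^{n} ( rᵢ + √(rᵢ+1)·√(rᵢ-1) ), where Log is the principal complex logarithm and √z the principal complex square root. -/

import Mathlib

open Real Complex MeasureTheory intervalIntegral Finset

/-- The principal complex square root, `√z = exp((1/2) Log z)` (with `√0 = 0`). -/
noncomputable def csqrt (z : ℂ) : ℂ := z ^ (1/2 : ℂ)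

lemma csqrt_sq (z : ℂ) : csqrt z ^ 2 = z := by
  have h := Complex.cpow_nat_inv_pow z (n := 2) (by norm_num)
  unfold csqrt
  rw [one_div]
  exact_mod_cast h

lemma csqrt_signs (z : ℂ) : 0 ≤ (csqrt z).re ∧ (0 ≤ z.im → 0 ≤ (csqrt z).im) ∧
    (z.im < 0 → (csqrt z).im ≤ 0) := by
  by_cases hz : z = 0
  · subst hz
    simp [csqrt]
  have hre : (Complex.log z * (1/2 : ℂ)).im = z.arg / 2 := by
    have : (1/2 : ℂ) = ((1/2 : ℝ) : ℂ) := by push_cast; rfl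
    rw [this, Complex.im_mul_ofReal, Complex.log_im]; ring
  have h1 := Complex.neg_pi_lt_arg z
  have h2 := Complex.arg_le_pi z
  unfold csqrt
  rw [Complex.cpow_def_of_ne_zero hz, Complex.exp_re, Complex.exp_im, hre]
  refine ⟨?_, ?_, ?_⟩
  · exact mul_nonneg (Real.exp_pos _).le
      (Real.cos_nonneg_of_neg_pi_div_two_le_of_le (by linarith) (by linarith))
  · intro h
    have := Complex.arg_nonneg_iff.2 h
    exact mul_nonneg (Real.exp_pos _).le
      (Real.sin_nonneg_of_nonneg_of_le_pi (by linarith) (by linarith))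
  · intro h
    have := Complex.arg_neg_iff.2 h
    exact mul_nonpos_of_nonneg_of_nonpos (Real.exp_pos _).le
      (Real.sin_nonpos_of_nonpos_of_neg_pi_le (by linarith) (by linarith))

lemma one_lt_norm_root (r : ℂ) (hr : ∀ x : ℝ, x ∈ Set.Icc (-1 : ℝ) 1 → r ≠ x) :
    1 < ‖r + csqrt (r + 1) * csqrt (r - 1)‖ ∧
    (r + csqrt (r + 1) * csqrt (r - 1)) * (r - csqrt (r + 1) * csqrt (r - 1)) = 1 := by
  have ha := csqrt_sq (r + 1)
  have hb := csqrt_sq (r - 1)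
  obtain ⟨ha1, ha2, ha3⟩ := csqrt_signs (r + 1)
  obtain ⟨hb1, hb2, hb3⟩ := csqrt_signs (r - 1)
  simp only [Complex.add_im, Complex.sub_im, Complex.one_im, add_zero, sub_zero] at ha2 ha3 hb2 hb3
  generalize csqrt (r + 1) = a at *
  generalize csqrt (r - 1) = b at *
  have hprod : (r + a * b) * (r - a * b) = 1 := by
    have : (r + a * b) * (r - a * b) = r ^ 2 - a ^ 2 * b ^ 2 := by ring
    rw [this, ha, hb]; ring
  refine ⟨?_, hprod⟩
  have hpos : 0 ≤ a.re * b.re + a.im * b.im := by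
    have h1 := mul_nonneg ha1 hb1
    rcases le_or_gt 0 r.im with h | h
    · have := mul_nonneg (ha2 h) (hb2 h); linarith
    · have := mul_nonneg_of_nonpos_of_nonpos (ha3 h) (hb3 h); linarith
  have hr2 : r = (a ^ 2 + b ^ 2) / 2 := by rw [ha, hb]; ring
  have hdiff : Complex.normSq (r + a * b) - Complex.normSq (r - a * b) =
      2 * (Complex.normSq a + Complex.normSq b) * (a.re * b.re + a.im * b.im) := by
    have hre : r.re = (a.re ^ 2 - a.im ^ 2 + b.re ^ 2 - b.im ^ 2) / 2 := by
      have h2 : 2 * r = a ^ 2 + b ^ 2 := by rw [ha, hb]; ring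
      have := congrArg Complex.re h2
      simp [pow_two] at this
      linarith
    have him : r.im = a.re * a.im + b.re * b.im := by
      have h2 : 2 * r = a ^ 2 + b ^ 2 := by rw [ha, hb]; ring
      have := congrArg Complex.im h2
      simp [pow_two] at this
      linarith
    simp only [Complex.normSq_apply, Complex.add_re, Complex.add_im, Complex.sub_re,
      Complex.sub_im, Complex.mul_re, Complex.mul_im, hre, him]
    ring
  have hge : Complex.normSq (r - a * b) ≤ Complex.normSq (r + a * b) := by
    have := mul_nonneg (mul_nonneg (zero_le_two (α := ℝ))
      (add_nonneg (Complex.normSq_nonneg a) (Complex.normSq_nonneg b))) hpos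
    linarith
  have hnp : Complex.normSq (r + a * b) * Complex.normSq (r - a * b) = 1 := by
    rw [← Complex.normSq_mul, hprod, Complex.normSq_one]
  by_contra hcon
  push Not at hcon
  have hsq : Complex.normSq (r + a * b) ≤ 1 := by
    rw [Complex.normSq_eq_norm_sq]; exact pow_le_one₀ (norm_nonneg _) hcon
  have hone : Complex.normSq (r + a * b) = 1 := by
    have := Complex.normSq_nonneg (r - a * b)
    nlinarith
  have hconj : r - a * b = (starRingEnd ℂ) (r + a * b) := by
    have h0 : r + a * b ≠ 0 := left_ne_zero_of_mul_eq_one hprod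
    apply mul_left_cancel₀ h0
    rw [hprod, Complex.mul_conj, hone]; simp
  have hrr : r = ((r + a * b).re : ℂ) := by
    have := Complex.add_conj (r + a * b)
    rw [← hconj] at this
    push_cast at this
    linear_combination this / 2
  exact hr _ (abs_le.1 ((Complex.abs_re_le_norm _).trans hcon)) hrr

lemma slit_aux (w z : ℂ) (hw : ‖w‖ < 1) (hz : ‖z‖ ≤ 1) : 1 - w * z ∈ Complex.slitPlane := by
  rw [sub_eq_add_neg]
  apply Complex.mem_slitPlane_of_norm_lt_one
  rw [norm_neg, norm_mul]
  nlinarith [norm_nonneg w, norm_nonneg z]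

lemma cont_aux (w : ℂ) (hw : ‖w‖ < 1) :
    Continuous fun θ : ℝ => Complex.log (1 - w * Complex.exp (θ * I)) := by
  apply Continuous.clog (by fun_prop)
  intro θ
  exact slit_aux w _ hw (Complex.norm_exp_ofReal_mul_I θ).le

lemma int_aux (w : ℂ) (hw : ‖w‖ < 1) :
    ∫ θ in (-π)..π, Complex.log (1 - w * Complex.exp (θ * I)) = 0 := by
  have hd : ∀ z : ℂ, ‖z‖ ≤ 1 → DifferentiableAt ℂ (fun z => Complex.log (1 - w * z)) z :=
    fun z hz => DifferentiableAt.clog (by fun_prop) (slit_aux w z hw hz)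
  have h := circleAverage_of_differentiable_on_off_countable (s := ∅) (c := 0) (R := 1)
    (f := fun z => Complex.log (1 - w * z)) Set.countable_empty
    (fun z hz => (hd z (by simpa using hz)).continuousAt.continuousWithinAt)
    (fun z hz => hd z (by have := hz.1; simp at this; exact this.le))
  rw [Real.circleAverage_def] at h
  have hper : Function.Periodic (fun θ : ℝ => Complex.log (1 - w * Complex.exp (θ * I)))
      (2 * π) := by
    intro θ
    have : ((θ + 2 * π : ℝ) : ℂ) * I = θ * I + 2 * π * I := by push_cast; ring
    simp only [this, Complex.exp_add, Complex.exp_two_pi_mul_I, mul_one]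
  have h2 := hper.intervalIntegral_add_eq (-π) 0
  rw [show -π + 2 * π = π by ring, zero_add] at h2
  rw [h2]
  simp [circleMap] at h
  simpa [Real.pi_ne_zero] using h

/-- Let `P(x) = α ∏ᵢ (rᵢ - x)` with `α ≠ 0` and `Re(P(x)) > 0` for all real `x ∈ [-1,1]`.
Then `exp((1/(2π)) ∫_{-π}^{π} Log(P(cos θ)) dθ) = (α/2ⁿ) ∏ᵢ (rᵢ + √(rᵢ+1)·√(rᵢ-1))`. -/
theorem exp_integral_log_poly (n : ℕ) (hn : 1 ≤ n) (α : ℂ) (hα : α ≠ 0)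
    (r : Fin n → ℂ) (P : ℂ → ℂ) (hP : ∀ x : ℂ, P x = α * ∏ i, (r i - x))
    (hre : ∀ x : ℝ, x ∈ Set.Icc (-1 : ℝ) 1 → 0 < (P (x : ℂ)).re) :
    Complex.exp ((1 / (2 * (π : ℂ))) * ∫ θ in (-π)..π, Complex.log (P (Real.cos θ))) =
      (α / 2 ^ n) * ∏ i, (r i + csqrt (r i + 1) * csqrt (r i - 1)) := by
  have hrne : ∀ i, ∀ x : ℝ, x ∈ Set.Icc (-1 : ℝ) 1 → r i ≠ x := by
    intro i x hx h
    have h1 := hre x hx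
    rw [hP, Finset.prod_eq_zero (Finset.mem_univ i) (by rw [h, sub_self])] at h1
    simp at h1
  have hs := fun i => one_lt_norm_root (r i) (hrne i)
  obtain ⟨s, hsdef⟩ : ∃ s : Fin n → ℂ,
      s = fun i => r i + csqrt (r i + 1) * csqrt (r i - 1) := ⟨_, rfl⟩
  obtain ⟨w, hwdef⟩ : ∃ w : Fin n → ℂ,
      w = fun i => r i - csqrt (r i + 1) * csqrt (r i - 1) := ⟨_, rfl⟩
  have hs1 : ∀ i, 1 < ‖s i‖ := fun i => by rw [hsdef]; exact (hs i).1
  have hsw : ∀ i, s i * w i = 1 := fun i => by rw [hsdef, hwdef]; exact (hs i).2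
  have hsum : ∀ i, r i = (s i + w i) / 2 := fun i => by rw [hsdef, hwdef]; ring
  have hs0 : ∀ i, s i ≠ 0 := fun i => left_ne_zero_of_mul_eq_one (hsw i)
  have hw1 : ∀ i, ‖w i‖ < 1 := by
    intro i
    have h := congrArg norm (hsw i)
    rw [norm_mul, norm_one] at h
    nlinarith [norm_nonneg (w i), hs1 i]
  have hgoal : (α / 2 ^ n) * ∏ i, (r i + csqrt (r i + 1) * csqrt (r i - 1)) =
      α * ∏ i, (s i / 2) := by
    rw [Finset.prod_div_distrib, hsdef]
    simp
    ring
  rw [hgoal]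
  have hC0 : α * ∏ i, (s i / 2) ≠ 0 :=
    mul_ne_zero hα (Finset.prod_ne_zero_iff.2 fun i _ => div_ne_zero (hs0 i) two_ne_zero)
  obtain ⟨c, hc⟩ : ∃ c, Complex.exp c = α * ∏ i, (s i / 2) := ⟨_, Complex.exp_log hC0⟩
  obtain ⟨g, hg⟩ : ∃ g : Fin n → ℝ → ℂ, g = fun i (θ : ℝ) =>
      Complex.log (1 - w i * Complex.exp (θ * I)) := ⟨_, rfl⟩
  have hgc : ∀ i, Continuous (g i) := fun i => by rw [hg]; exact cont_aux (w i) (hw1 i)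
  have hgi : ∀ i, ∫ θ in (-π)..π, g i θ = 0 := fun i => by rw [hg]; exact int_aux (w i) (hw1 i)
  have hge : ∀ i θ, Complex.exp (g i θ) = 1 - w i * Complex.exp (θ * I) := by
    intro i θ
    rw [hg]
    exact Complex.exp_log (Complex.slitPlane_ne_zero
      (slit_aux _ _ (hw1 i) (Complex.norm_exp_ofReal_mul_I θ).le))
  have hgi' : ∀ i, ∫ θ in (-π)..π, g i (-θ) = 0 := fun i => by
    rw [intervalIntegral.integral_comp_neg, neg_neg]; exact hgi i
  obtain ⟨S, hS⟩ : ∃ S : ℝ → ℂ, S = fun θ => ∑ i, (g i θ + g i (-θ)) := ⟨_, rfl⟩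
  have hgc' : ∀ i, Continuous fun θ => g i (-θ) := fun i => (hgc i).comp continuous_neg
  have hSc : Continuous S := by
    rw [hS]
    exact continuous_finsetSum _ fun i _ => (hgc i).add (hgc' i)
  have hSi : ∫ θ in (-π)..π, S θ = 0 := by
    simp only [hS]
    rw [intervalIntegral.integral_finsetSum (f := fun i θ => g i θ + g i (-θ))
      (fun i _ => ((hgc i).add (hgc' i)).intervalIntegrable _ _)]
    apply Finset.sum_eq_zero
    intro i _
    rw [intervalIntegral.integral_add ((hgc i).intervalIntegrable _ _)
      ((hgc' i).intervalIntegrable _ _), hgi, hgi', add_zero]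
  have hmem : ∀ θ : ℝ, 0 < (P (Real.cos θ)).re := fun θ => hre _ (Real.cos_mem_Icc θ)
  have hexp : ∀ θ : ℝ, Complex.exp (c + S θ) = P (Real.cos θ) := by
    intro θ
    rw [Complex.exp_add, hc, hS, Complex.exp_sum, hP, mul_assoc, ← Finset.prod_mul_distrib]
    congr 1
    apply Finset.prod_congr rfl
    intro i _
    rw [Complex.exp_add, hge, hge, hsum, Complex.ofReal_cos, Complex.cos]
    have he : Complex.exp (θ * I) * Complex.exp (((-θ : ℝ) : ℂ) * I) = 1 := by
      rw [← Complex.exp_add]; simp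
    rw [show -(θ : ℂ) * I = ((-θ : ℝ) : ℂ) * I by push_cast; ring]
    generalize Complex.exp (θ * I) = e at *
    generalize Complex.exp (((-θ : ℝ) : ℂ) * I) = f at *
    linear_combination (s i * w i * w i / 2) * he + (w i / 2 - (e + f) / 2) * hsw i
  have hPc : Continuous fun θ : ℝ => Complex.log (P (Real.cos θ)) := by
    apply Continuous.clog
    · have : P = fun x => α * ∏ i, (r i - x) := funext hP
      rw [this]
      fun_prop
    · exact fun θ => Or.inl (hmem θ)
  have hk : ∀ θ : ℝ, ∃ k : ℤ, Complex.log (P (Real.cos θ)) = c + S θ + k * (2 * π * I) := by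
    intro θ
    rw [← Complex.exp_eq_exp_iff_exists_int, hexp, Complex.exp_log]
    intro h
    have := hmem θ
    rw [h] at this
    simp at this
  choose k hk using hk
  have hkc : Continuous k := by
    rw [Int.isClosedEmbedding_coe_real.isInducing.continuous_iff]
    have : ((fun m : ℤ => (m : ℝ)) ∘ k) =
        fun θ => ((Complex.log (P (Real.cos θ)) - (c + S θ)) / (2 * π * I)).re := by
      funext θ
      rw [hk θ, add_sub_cancel_left, mul_div_cancel_right₀ _ Complex.two_pi_I_ne_zero]
      simp
    rw [this]
    exact Complex.continuous_re.comp
      ((hPc.sub (continuous_const.add hSc)).div_const _)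
  have hk0 : ∀ θ, k θ = k 0 := fun θ => PreconnectedSpace.constant inferInstance hkc
  have hint : ∫ θ in (-π)..π, Complex.log (P (Real.cos θ)) =
      2 * π * (c + k 0 * (2 * π * I)) := by
    have : ∀ θ : ℝ, Complex.log (P (Real.cos θ)) = (c + k 0 * (2 * π * I)) + S θ := by
      intro θ
      rw [hk θ, hk0 θ]; ring
    simp_rw [this]
    rw [intervalIntegral.integral_add (by simp) (hSc.intervalIntegrable _ _), hSi,
      intervalIntegral.integral_const, add_zero, Complex.real_smul]
    push_cast
    ring
  have hpi : (π : ℂ) ≠ 0 := by exact_mod_cast Real.pi_ne_zero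
  rw [hint, ← mul_assoc, one_div, inv_mul_cancel₀ (mul_ne_zero two_ne_zero hpi), one_mul, ← hc]
  exact Complex.exp_eq_exp_iff_exists_int.2 ⟨k 0, rfl⟩
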